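/- Let γ, η_0 > 0, let L > 0, and let integers n, m satisfy n ≥ m ≥ 2. Let c > 0 satisfy (1+γ)^m ≥ 4c²/(γ η_0 L). If η_k = η_0 (1+γ)^k for all k ∈ {0, …, n+1} and H_{n+1} = Σ_{k=0}^{n+1} η_k, then H_{n+1} ≥ (η_0 γ (1+γ)^m / 4)·(n − m + 2)² ≥ (c²/L)·(n + 1 − m)². -/

import Mathlib

/-- Second-order Bernoulli inequality. -/
theorem second_order_bernoulli {x : ℝ} (hx : 0 ≤ x) (p : ℕ) :
    1 + p * x + p * (p - 1) / 2 * x ^ 2 ≤ (1 + x) ^ p := by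
  induction p with
  | zero => simp
  | succ p ih =>
    have hp : (0 : ℝ) ≤ p * (p - 1) := by
      rcases p with _ | p
      · simp
      · push_cast
        rw [add_sub_cancel_right]
        positivity
    have h := mul_le_mul_of_nonneg_right ih (by linarith : 0 ≤ 1 + x)
    have h3 : 0 ≤ (p * (p - 1) : ℝ) * x ^ 3 := by positivity
    rw [pow_succ (1 + x) p]
    push_cast
    linarith

/-- Case 2a of the proof of Theorem 2: geometric stepsize growth. -/
theorem geometric_stepsize_H_lower_bound
    (γ η₀ L c : ℝ) (hγ : 0 < γ) (hη₀ : 0 < η₀) (hL : 0 < L) (hc : 0 < c)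
    (n m : ℕ) (hm : 2 ≤ m) (hnm : m ≤ n)
    (hgm : 4 * c^2 / (γ * η₀ * L) ≤ (1+γ)^m)
    (η : ℕ → ℝ) (hη : ∀ k ≤ n + 1, η k = η₀ * (1+γ)^k)
    (Hval : ℝ) (hH : Hval = ∑ k ∈ Finset.range (n+2), η k) :
    η₀ * γ * (1+γ)^m / 4 * ((n : ℝ) - (m : ℝ) + 2)^2 ≤ Hval ∧
      c^2 / L * ((n : ℝ) + 1 - (m : ℝ))^2 ≤ η₀ * γ * (1+γ)^m / 4 * ((n : ℝ) - (m : ℝ) + 2)^2 := by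
  obtain ⟨d, rfl⟩ := Nat.exists_eq_add_of_le hnm
  have hd : (0 : ℝ) ≤ d := d.cast_nonneg
  have hsub : ((m + d : ℕ) : ℝ) - m = d := by push_cast; ring
  have hsub' : ((m + d : ℕ) : ℝ) + 1 - m = d + 1 := by push_cast; ring
  rw [hsub, hsub']
  constructor
  · have hsum : Hval * γ = η₀ * ((1 + γ) ^ (m + d + 2) - 1) := by
      have hgeom := geom_sum_mul (1 + γ) (m + d + 2)
      rw [add_sub_cancel_left] at hgeom
      rw [← hgeom, hH, ← mul_assoc, Finset.mul_sum]
      congr 1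
      exact Finset.sum_congr rfl fun k hk => hη k (by simp at hk; omega)
    have hbern := second_order_bernoulli hγ.le (d + 2)
    push_cast at hbern
    have hquad : γ ^ 2 * ((d : ℝ) + 2) ^ 2 / 4 ≤ (1 + γ) ^ (d + 2) - 1 := by
      have h₁ : 0 ≤ (d : ℝ) * γ := by positivity
      have h₂ : 0 ≤ (d : ℝ) * γ ^ 2 := by positivity
      have h₃ : 0 ≤ (d : ℝ) ^ 2 * γ ^ 2 := by positivity
      linarith
    have hone : 1 ≤ (1 + γ) ^ m := one_le_pow₀ (by linarith)
    refine le_of_mul_le_mul_right ?_ hγ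
    rw [hsum]
    calc η₀ * γ * (1 + γ) ^ m / 4 * ((d : ℝ) + 2) ^ 2 * γ
        = η₀ * ((1 + γ) ^ m * (γ ^ 2 * ((d : ℝ) + 2) ^ 2 / 4)) := by ring
      _ ≤ η₀ * ((1 + γ) ^ m * ((1 + γ) ^ (d + 2) - 1)) := by gcongr
      _ = η₀ * ((1 + γ) ^ (m + d + 2) - (1 + γ) ^ m) := by ring
      _ ≤ η₀ * ((1 + γ) ^ (m + d + 2) - 1) := by gcongr
  · have hcoef : c ^ 2 / L ≤ η₀ * γ * (1 + γ) ^ m / 4 := by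
      rw [div_le_iff₀ (by positivity)] at hgm ⊢
      linarith
    gcongr
    norm_num
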